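/- Let $d \ge 2$ and $1/2 < s < 1$. There is a constant $C = C(d,s) > 0$ such that for every radial Schwartz function $u$ on $\mathbb{R}^d$ and every $x \in \mathbb{R}^d$, $|x|^{(d-2s)/2}\,|u(x)| \le C\,\|u\|_{\dot H^s}$. -/

import Mathlib

open MeasureTheory Complex
open scoped ENNReal BigOperators RealInnerProductSpace

noncomputable section

abbrev Ed (d : ℕ) := EuclideanSpace ℝ (Fin d)

/-- Fourier transform with convention `(𝓕 f) ξ = ∫ e^{-i x·ξ} f x dx`. -/
def FT {d : ℕ} (f : Ed d → ℂ) (ξ : Ed d) : ℂ :=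
  ∫ x : Ed d, Complex.exp (-Complex.I * ((⟪x, ξ⟫ : ℝ) : ℂ)) * f x

/-- Inverse Fourier transform `(2π)^{-d} ∫ e^{i x·ξ} g ξ dξ`. -/
def FTinv {d : ℕ} (g : Ed d → ℂ) (x : Ed d) : ℂ :=
  (((2 * Real.pi) ^ (-(d : ℝ)) : ℝ) : ℂ) *
    ∫ ξ : Ed d, Complex.exp (Complex.I * ((⟪x, ξ⟫ : ℝ) : ℂ)) * g ξ

/-- Fractional Schrödinger propagator `e^{-it(-Δ)^s}`. -/
def fprop {d : ℕ} (s t : ℝ) (f : Ed d → ℂ) : Ed d → ℂ :=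
  FTinv (fun ξ => Complex.exp (-Complex.I * (t : ℂ) * ((‖ξ‖ ^ (2 * s) : ℝ) : ℂ)) * FT f ξ)

/-- Fractional derivative `D^σ = (-Δ)^{σ/2}`, the Fourier multiplier `|ξ|^σ`. -/
def fracD {d : ℕ} (σ : ℝ) (f : Ed d → ℂ) : Ed d → ℂ :=
  FTinv (fun ξ => ((‖ξ‖ ^ σ : ℝ) : ℂ) * FT f ξ)

/-- `(-Δ)^{β/2} e^{-it(-Δ)^s}`. -/
def fracDProp {d : ℕ} (β s t : ℝ) (f : Ed d → ℂ) : Ed d → ℂ :=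
  FTinv (fun ξ => ((‖ξ‖ ^ β : ℝ) : ℂ) *
    Complex.exp (-Complex.I * (t : ℂ) * ((‖ξ‖ ^ (2 * s) : ℝ) : ℂ)) * FT f ξ)

/-- Resolvent `(-Δ + λ)⁻¹`. -/
def resolv {d : ℕ} (lam : ℝ) (f : Ed d → ℂ) : Ed d → ℂ :=
  FTinv (fun ξ => FT f ξ / ((‖ξ‖ ^ 2 + lam : ℝ) : ℂ))

/-- Resolvent-regularization `u_λ = √(sin(πs)/π) (-Δ+λ)⁻¹ u`. -/
def reg {d : ℕ} (s lam : ℝ) (f : Ed d → ℂ) : Ed d → ℂ :=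
  fun x => ((Real.sqrt (Real.sin (Real.pi * s) / Real.pi) : ℝ) : ℂ) * resolv lam f x

/-- A function is radial if its value depends only on `|x|`. -/
def IsRadial {d : ℕ} (f : Ed d → ℂ) : Prop :=
  ∀ x y : Ed d, ‖x‖ = ‖y‖ → f x = f y

/-- Homogeneous Sobolev norm `‖f‖_{Ḣ^s} = (2π)^{-d/2} ‖ |ξ|^s 𝓕f ‖_{L²}`. -/
def HdotNorm {d : ℕ} (s : ℝ) (f : Ed d → ℂ) : ℝ :=
  (2 * Real.pi) ^ (-(d : ℝ) / 2) *
    (eLpNorm (fun ξ : Ed d => ((‖ξ‖ ^ s : ℝ) : ℂ) * FT f ξ) 2 volume).toReal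

/-- Inhomogeneous Sobolev norm `‖f‖_{H^s}² = ‖f‖_{L²}² + ‖f‖_{Ḣ^s}²`. -/
def HNorm {d : ℕ} (s : ℝ) (f : Ed d → ℂ) : ℝ :=
  Real.sqrt ((eLpNorm f 2 volume).toReal ^ 2 + HdotNorm s f ^ 2)

/-- Mixed space-time norm `L^q_t L^r_x (ℝ × ℝ^d)`. -/
def mixedNorm {d : ℕ} (q r : ℝ≥0∞) (F : ℝ → Ed d → ℂ) : ℝ≥0∞ :=
  eLpNorm (fun t => (eLpNorm (F t) r volume).toReal) q volume

/-- Partial derivative `∂_j` of a complex-valued function. -/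
def pd {d : ℕ} (j : Fin d) (f : Ed d → ℂ) (x : Ed d) : ℂ :=
  fderiv ℝ f x (EuclideanSpace.single j 1)

/-- Partial derivative `∂_j` of a real-valued function. -/
def pdR {d : ℕ} (j : Fin d) (f : Ed d → ℝ) (x : Ed d) : ℝ :=
  fderiv ℝ f x (EuclideanSpace.single j 1)

/-- Laplacian of a real-valued function. -/
def lapR {d : ℕ} (f : Ed d → ℝ) : Ed d → ℝ :=
  fun x => ∑ j : Fin d, pdR j (pdR j f) x

/-- Rescaling `χ_R(x) = χ(x/R)`. -/
def chiR {d : ℕ} (χ : Ed d → ℝ) (R : ℝ) : Ed d → ℝ :=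
  fun x => χ (R⁻¹ • x)


/-- Squared `H^{1/2}` norm `(2π)^{-d} ∫ (1+|ξ|²)^{1/2} |𝓕u(ξ)|² dξ`. -/
def H12sq {d : ℕ} (f : Ed d → ℂ) : ℝ :=
  (2 * Real.pi) ^ (-(d : ℝ)) * ∫ ξ : Ed d, (1 + ‖ξ‖ ^ 2) ^ ((1 : ℝ)/2) * ‖FT f ξ‖ ^ 2

lemma sq_norm_charFun_eq_integral_prod {d : ℕ} (μ : Measure (Ed d)) [IsFiniteMeasure μ] (ξ : Ed d) :
    ((‖charFun μ ξ‖ ^ 2 : ℝ) : ℂ) =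
      ∫ p : Ed d × Ed d, cexp (I * (⟪p.1 - p.2, ξ⟫ : ℝ)) ∂(μ.prod μ) := by
  have h : ((‖charFun μ ξ‖ ^ 2 : ℝ) : ℂ) = charFun μ ξ * charFun μ (-ξ) := by
    rw [charFun_neg, Complex.mul_conj, Complex.normSq_eq_norm_sq]
  rw [h, charFun_apply, charFun_apply, ← integral_prod_mul]
  congr 1 with p
  rw [← Complex.exp_add, inner_sub_left, inner_neg_right]
  push_cast
  ring_nf

lemma integrable_exp_neg_mul_sq_norm {d : ℕ} {t : ℝ} (ht : 0 < t) :
    Integrable (fun ξ : Ed d => Real.exp (-t * ‖ξ‖ ^ 2)) := by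
  have h := (GaussianFourier.integrable_cexp_neg_mul_sq_norm_add (V := Ed d) (b := (t : ℂ))
    (by simpa using ht) 0 0).norm
  refine h.congr (Filter.Eventually.of_forall fun ξ => ?_)
  simp only [Complex.norm_exp]
  norm_cast
  simp

lemma integral_gaussian_mul_sq_norm_charFun {d : ℕ} (μ : Measure (Ed d)) [IsFiniteMeasure μ]
    {t : ℝ} (ht : 0 < t) :
    ∫ ξ : Ed d, Real.exp (-t * ‖ξ‖ ^ 2) * ‖charFun μ ξ‖ ^ 2 =
      (Real.pi / t) ^ ((d : ℝ) / 2) *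
        ∫ p : Ed d × Ed d, Real.exp (-(‖p.1 - p.2‖ ^ 2 / (4 * t))) ∂(μ.prod μ) := by
  apply Complex.ofReal_injective
  have hint : Integrable (Function.uncurry fun (ξ : Ed d) (p : Ed d × Ed d) =>
      cexp (I * (⟪p.1 - p.2, ξ⟫ : ℝ)) * (Real.exp (-t * ‖ξ‖ ^ 2) : ℂ))
      (volume.prod (μ.prod μ)) := by
    have hg : Integrable (fun ξ : Ed d => (Real.exp (-t * ‖ξ‖ ^ 2) : ℂ)) :=
      (integrable_exp_neg_mul_sq_norm ht).ofReal
    refine Integrable.bdd_mul (c := 1) (hg.comp_fst (μ.prod μ)) ?_ ?_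
    · exact Continuous.aestronglyMeasurable (by fun_prop)
    · exact Filter.Eventually.of_forall fun q => by rw [mul_comm I, Complex.norm_exp_ofReal_mul_I]
  have hgauss (p : Ed d × Ed d) :
      ∫ ξ : Ed d, cexp (I * (⟪p.1 - p.2, ξ⟫ : ℝ)) * (Real.exp (-t * ‖ξ‖ ^ 2) : ℂ) =
        (((Real.pi / t) ^ ((d : ℝ) / 2) * Real.exp (-(‖p.1 - p.2‖ ^ 2 / (4 * t))) : ℝ) : ℂ) := by
    have h := GaussianFourier.integral_cexp_neg_mul_sq_norm_add (V := Ed d) (b := (t : ℂ))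
      (by simpa using ht) I (p.1 - p.2)
    rw [finrank_euclideanSpace_fin, I_sq] at h
    rw [Complex.ofReal_mul, Complex.ofReal_cpow (by positivity)]
    push_cast
    convert h using 2
    · ext ξ
      rw [← Complex.exp_add]
      ring_nf
    · ring_nf
  calc ((∫ ξ : Ed d, Real.exp (-t * ‖ξ‖ ^ 2) * ‖charFun μ ξ‖ ^ 2 : ℝ) : ℂ)
      = ∫ ξ : Ed d, ∫ p : Ed d × Ed d,
          cexp (I * (⟪p.1 - p.2, ξ⟫ : ℝ)) * (Real.exp (-t * ‖ξ‖ ^ 2) : ℂ) ∂(μ.prod μ) := by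
        rw [← integral_complex_ofReal]
        congr 1 with ξ
        rw [integral_mul_const, ← sq_norm_charFun_eq_integral_prod]
        push_cast
        ring
    _ = _ := by
        rw [integral_integral_swap hint]
        simp_rw [hgauss]
        rw [integral_complex_ofReal, integral_const_mul]

lemma lintegral_gaussian_mul_sq_enorm_charFun {d : ℕ} (μ : Measure (Ed d)) [IsFiniteMeasure μ]
    {t : ℝ} (ht : 0 < t) :
    ∫⁻ ξ : Ed d, ENNReal.ofReal (Real.exp (-t * ‖ξ‖ ^ 2)) * ‖charFun μ ξ‖ₑ ^ 2 =
      ENNReal.ofReal ((Real.pi / t) ^ ((d : ℝ) / 2)) *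
        ∫⁻ x, ∫⁻ y, ENNReal.ofReal (Real.exp (-(‖x - y‖ ^ 2 / (4 * t)))) ∂μ ∂μ := by
  have hint : Integrable (fun ξ : Ed d => Real.exp (-t * ‖ξ‖ ^ 2) * ‖charFun μ ξ‖ ^ 2) := by
    refine Integrable.mul_bdd (c := μ.real Set.univ ^ 2) (integrable_exp_neg_mul_sq_norm ht) ?_ ?_
    · exact Measurable.aestronglyMeasurable (by fun_prop)
    · refine Filter.Eventually.of_forall fun ξ => ?_
      rw [norm_pow, norm_norm]
      gcongr
      exact norm_charFun_le ξ
  have hint' : Integrable (fun p : Ed d × Ed d => Real.exp (-(‖p.1 - p.2‖ ^ 2 / (4 * t))))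
      (μ.prod μ) := by
    refine Integrable.of_bound (C := 1) (Continuous.aestronglyMeasurable (by fun_prop)) ?_
    refine Filter.Eventually.of_forall fun p => ?_
    rw [Real.norm_eq_abs, Real.abs_exp, Real.exp_le_one_iff]
    have : 0 ≤ ‖p.1 - p.2‖ ^ 2 / (4 * t) := by positivity
    linarith
  have h := congrArg ENNReal.ofReal (integral_gaussian_mul_sq_norm_charFun μ ht)
  rw [ENNReal.ofReal_mul (by positivity),
    ofReal_integral_eq_lintegral_ofReal hint (Filter.Eventually.of_forall fun _ => by positivity),
    ofReal_integral_eq_lintegral_ofReal hint' (Filter.Eventually.of_forall fun _ => by positivity),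
    lintegral_prod _ (by fun_prop)] at h
  rw [← h]
  congr 1 with ξ
  rw [ENNReal.ofReal_mul (by positivity), ENNReal.ofReal_pow (norm_nonneg _), ofReal_norm]

open scoped Pointwise in
lemma toSphere_ball_le {d : ℕ} (hd : 2 ≤ d) : ∃ C : ℝ, 0 ≤ C ∧
    ∀ (x : Metric.sphere (0 : Ed d) 1) (r : ℝ), 0 < r →
      (volume : Measure (Ed d)).toSphere (Metric.ball x r) ≤ ENNReal.ofReal (C * r ^ (d - 1)) := by
  have : Nonempty (Fin d) := ⟨⟨0, by omega⟩⟩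
  set ω : ℝ := (volume : Measure (Ed d)).real (Metric.ball 0 1) with hω
  have hω0 : 0 ≤ ω := measureReal_nonneg
  have hωe : volume (Metric.ball (0 : Ed d) 1) = ENNReal.ofReal ω := by
    rw [hω, ofReal_measureReal]
  refine ⟨d * (2 * 2 ^ d * ω), by positivity, fun x r hr => ?_⟩
  rcases le_or_gt 1 r with h1 | h1
  · calc (volume : Measure (Ed d)).toSphere (Metric.ball x r)
        ≤ (volume : Measure (Ed d)).toSphere Set.univ := measure_mono (Set.subset_univ _)
      _ = ENNReal.ofReal (d * ω) := by
        rw [Measure.toSphere_apply_univ, finrank_euclideanSpace_fin, hωe,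
          ENNReal.ofReal_mul (by positivity), ENNReal.ofReal_natCast]
      _ ≤ _ := by
        apply ENNReal.ofReal_le_ofReal
        have h2 : (1 : ℝ) ≤ r ^ (d - 1) := one_le_pow₀ h1
        have h3 : (1 : ℝ) ≤ 2 ^ d := one_le_pow₀ (by norm_num)
        calc (d * ω : ℝ) = d * (1 * 1 * ω) * 1 := by ring
          _ ≤ d * (2 * 2 ^ d * ω) * r ^ (d - 1) := by gcongr; norm_num
  · have hcover : Set.Ioo (0 : ℝ) 1 • ((↑) '' Metric.ball x r : Set (Ed d)) ⊆
        ⋃ k ∈ Finset.range (⌊1 / r⌋₊ + 1), Metric.ball ((k * r : ℝ) • (x : Ed d)) (2 * r) := by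
      rintro _ ⟨t, ⟨ht0, ht1⟩, _, ⟨y, hy, rfl⟩, rfl⟩
      simp only [Set.mem_iUnion, Finset.mem_range, Nat.lt_add_one_iff, exists_prop]
      refine ⟨⌊t / r⌋₊, Nat.floor_le_floor (by gcongr), ?_⟩
      have hx : ‖(x : Ed d)‖ = 1 := by simp
      have hy' : ‖(y : Ed d) - x‖ < r := by
        rw [Metric.mem_ball, Subtype.dist_eq, dist_eq_norm] at hy; exact hy
      have hfl : (⌊t / r⌋₊ : ℝ) * r ≤ t := by
        rw [← le_div_iff₀ hr]; exact Nat.floor_le (by positivity)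
      have hfl' : t < (⌊t / r⌋₊ : ℝ) * r + r := by
        have := Nat.lt_floor_add_one (t / r)
        rw [div_lt_iff₀ hr] at this
        linarith
      rw [Metric.mem_ball, dist_eq_norm]
      have heq : t • (y : Ed d) - (⌊t / r⌋₊ * r : ℝ) • (x : Ed d) =
          t • ((y : Ed d) - x) + (t - ⌊t / r⌋₊ * r) • (x : Ed d) := by
        module
      calc ‖t • (y : Ed d) - (⌊t / r⌋₊ * r : ℝ) • (x : Ed d)‖
          ≤ ‖t • ((y : Ed d) - x)‖ + ‖(t - ⌊t / r⌋₊ * r) • (x : Ed d)‖ := by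
            rw [heq]; exact norm_add_le _ _
        _ = t * ‖(y : Ed d) - x‖ + (t - ⌊t / r⌋₊ * r) := by
            rw [norm_smul, norm_smul, hx, Real.norm_of_nonneg ht0.le,
              Real.norm_of_nonneg (by linarith), mul_one]
        _ < 2 * r := by nlinarith [norm_nonneg ((y : Ed d) - x)]
    rw [Measure.toSphere_apply' _ Metric.isOpen_ball.measurableSet, finrank_euclideanSpace_fin]
    have hball (k : ℕ) : volume (Metric.ball ((k * r : ℝ) • (x : Ed d)) (2 * r)) =
        ENNReal.ofReal ((2 * r) ^ d * ω) := by
      rw [Measure.addHaar_ball _ _ (by positivity), finrank_euclideanSpace_fin, hωe,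
        ENNReal.ofReal_mul (by positivity)]
    calc (d : ℝ≥0∞) * volume (Set.Ioo (0 : ℝ) 1 • ((↑) '' Metric.ball x r : Set (Ed d)))
        ≤ d * ∑ k ∈ Finset.range (⌊1 / r⌋₊ + 1),
            volume (Metric.ball ((k * r : ℝ) • (x : Ed d)) (2 * r)) := by
          gcongr
          exact (measure_mono hcover).trans (measure_biUnion_finset_le _ _)
      _ = ENNReal.ofReal (d * ((⌊1 / r⌋₊ + 1 : ℝ) * ((2 * r) ^ d * ω))) := by
          simp_rw [hball]
          rw [Finset.sum_const, Finset.card_range, nsmul_eq_mul, ← ENNReal.ofReal_natCast,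
            ← ENNReal.ofReal_natCast, ← ENNReal.ofReal_mul (by positivity),
            ← ENNReal.ofReal_mul (by positivity)]
          push_cast
          rfl
      _ ≤ _ := by
          apply ENNReal.ofReal_le_ofReal
          have hN : (⌊1 / r⌋₊ + 1 : ℝ) ≤ 2 / r := by
            have h2 : (⌊1 / r⌋₊ : ℝ) ≤ 1 / r := Nat.floor_le (by positivity)
            have h3 : 1 ≤ 1 / r := by rw [le_div_iff₀ hr]; linarith
            have h4 : 2 / r = 1 / r + 1 / r := by ring
            linarith
          have hpow : r ^ d = r ^ (d - 1) * r := by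
            rw [← pow_succ]; congr 1; omega
          calc d * ((⌊1 / r⌋₊ + 1 : ℝ) * ((2 * r) ^ d * ω))
              ≤ d * (2 / r * ((2 * r) ^ d * ω)) := by gcongr
            _ = _ := by
              rw [mul_pow, hpow]
              field_simp

lemma lintegral_Ioi_exp_neg (a : ℝ) :
    ∫⁻ b in Set.Ioi a, ENNReal.ofReal (Real.exp (-b)) = ENNReal.ofReal (Real.exp (-a)) := by
  rw [← integral_exp_neg_Ioi a, ofReal_integral_eq_lintegral_ofReal (integrableOn_exp_neg_Ioi a)
    (Filter.Eventually.of_forall fun _ => by positivity)]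

lemma lintegral_gaussian_le_of_ball_le {d n : ℕ} {μ : Measure (Ed d)} [IsFiniteMeasure μ] {C : ℝ}
    (hC : 0 ≤ C) {x : Ed d}
    (hx : ∀ r : ℝ, 0 < r → μ (Metric.ball x r) ≤ ENNReal.ofReal (C * r ^ n)) {t : ℝ} (ht : 0 < t) :
    ∫⁻ y, ENNReal.ofReal (Real.exp (-(‖x - y‖ ^ 2 / (4 * t)))) ∂μ ≤
      ENNReal.ofReal (C * 2 ^ n * Real.Gamma ((n : ℝ) / 2 + 1) * t ^ ((n : ℝ) / 2)) := by
  have hlayer (y : Ed d) : ENNReal.ofReal (Real.exp (-(‖x - y‖ ^ 2 / (4 * t)))) =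
      ∫⁻ b in Set.Ioi (0 : ℝ), {p : Ed d × ℝ | ‖x - p.1‖ ^ 2 / (4 * t) < p.2}.indicator
        (fun p => ENNReal.ofReal (Real.exp (-p.2))) (y, b) := by
    rw [← lintegral_Ioi_exp_neg, ← lintegral_indicator measurableSet_Ioi,
      ← lintegral_indicator measurableSet_Ioi]
    congr 1 with b
    have h0 : 0 ≤ ‖x - y‖ ^ 2 / (4 * t) := by positivity
    by_cases hb : ‖x - y‖ ^ 2 / (4 * t) < b
    · have hb0 : 0 < b := h0.trans_lt hb
      simp [hb, hb0]
    · simp [Set.indicator, hb]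
  have hmeas : MeasurableSet {p : Ed d × ℝ | ‖x - p.1‖ ^ 2 / (4 * t) < p.2} :=
    measurableSet_lt (by fun_prop) (by fun_prop)
  have hgamma : IntegrableOn (fun b : ℝ => Real.exp (-b) * b ^ ((n : ℝ) / 2 + 1 - 1)) (Set.Ioi 0) :=
    Real.GammaIntegral_convergent (by positivity)
  have hslice (b : ℝ) (hb : 0 < b) :
      ∫⁻ y, {p : Ed d × ℝ | ‖x - p.1‖ ^ 2 / (4 * t) < p.2}.indicator
        (fun p => ENNReal.ofReal (Real.exp (-p.2))) (y, b) ∂μ ≤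
      ENNReal.ofReal (C * 2 ^ n * t ^ ((n : ℝ) / 2)) *
        ENNReal.ofReal (Real.exp (-b) * b ^ ((n : ℝ) / 2 + 1 - 1)) := by
    have hset : ∀ y, {p : Ed d × ℝ | ‖x - p.1‖ ^ 2 / (4 * t) < p.2}.indicator
        (fun p => ENNReal.ofReal (Real.exp (-p.2))) (y, b) =
        (Metric.ball x (2 * √(t * b))).indicator
          (fun _ => ENNReal.ofReal (Real.exp (-b))) y := by
      intro y
      have hiff : ‖x - y‖ ^ 2 / (4 * t) < b ↔ y ∈ Metric.ball x (2 * √(t * b)) := by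
        rw [Metric.mem_ball', dist_eq_norm, div_lt_iff₀ (by positivity),
          ← sq_lt_sq₀ (norm_nonneg _) (by positivity), mul_pow, Real.sq_sqrt (by positivity)]
        ring_nf
      simp only [Set.indicator, Set.mem_ofPred_eq, ← hiff]
    simp_rw [hset]
    rw [lintegral_indicator_const Metric.isOpen_ball.measurableSet]
    refine (mul_le_mul_right (hx _ (by positivity)) _).trans_eq ?_
    rw [← ENNReal.ofReal_mul (by positivity), ← ENNReal.ofReal_mul (by positivity)]
    congr 1
    rw [Real.sqrt_eq_rpow, mul_pow, ← Real.rpow_natCast (_ ^ _), ← Real.rpow_mul (by positivity),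
      Real.mul_rpow ht.le hb.le]
    ring_nf
  simp_rw [hlayer]
  have hmeas' : Measurable ({p : Ed d × ℝ | ‖x - p.1‖ ^ 2 / (4 * t) < p.2}.indicator
      (fun p => ENNReal.ofReal (Real.exp (-p.2)))) := Measurable.indicator (by fun_prop) hmeas
  rw [lintegral_lintegral_swap (f := fun y b =>
    {p : Ed d × ℝ | ‖x - p.1‖ ^ 2 / (4 * t) < p.2}.indicator
      (fun p => ENNReal.ofReal (Real.exp (-p.2))) (y, b)) hmeas'.aemeasurable]
  refine (setLIntegral_mono' measurableSet_Ioi hslice).trans_eq ?_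
  rw [lintegral_const_mul _ (by fun_prop), ← ofReal_integral_eq_lintegral_ofReal hgamma
    ((ae_restrict_mem measurableSet_Ioi).mono fun b hb => by
      have : (0 : ℝ) < b := hb
      positivity), ← ENNReal.ofReal_mul (by positivity), Real.Gamma_eq_integral (by positivity)]
  ring_nf

lemma ofReal_rpow_norm_le_lintegral {d : ℕ} {s : ℝ} (hs : 0 < s) (ξ : Ed d) :
    ENNReal.ofReal (Real.Gamma s) * ENNReal.ofReal (‖ξ‖ ^ (-(2 * s))) ≤
      ∫⁻ t in Set.Ioi (0 : ℝ), ENNReal.ofReal (t ^ (s - 1)) *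
        ENNReal.ofReal (Real.exp (-t * ‖ξ‖ ^ 2)) := by
  rcases eq_or_ne ξ 0 with rfl | hξ
  · rw [norm_zero, Real.zero_rpow (by linarith)]
    simp
  have hpos : 0 < ‖ξ‖ ^ 2 := by positivity
  have hG := Real.Gamma_pos_of_pos hs
  have h := Real.integral_rpow_mul_exp_neg_mul_Ioi hs hpos
  have hint : IntegrableOn (fun t : ℝ => t ^ (s - 1) * Real.exp (-(‖ξ‖ ^ 2 * t))) (Set.Ioi 0) := by
    by_contra hcon
    rw [integral_undef hcon] at h
    have : 0 < (1 / ‖ξ‖ ^ 2) ^ s * Real.Gamma s := by positivity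
    linarith
  have h2 : (1 / ‖ξ‖ ^ 2) ^ s = ‖ξ‖ ^ (-(2 * s)) := by
    rw [Real.rpow_neg (norm_nonneg _), Real.rpow_mul (norm_nonneg _), one_div,
      Real.inv_rpow (by positivity), Real.rpow_two]
  rw [h2, mul_comm] at h
  rw [← ENNReal.ofReal_mul hG.le, ← h, ofReal_integral_eq_lintegral_ofReal hint
    ((ae_restrict_mem measurableSet_Ioi).mono fun b hb => by
      have : (0 : ℝ) < b := hb
      positivity)]
  refine (setLIntegral_congr_fun measurableSet_Ioi fun t ht => ?_).le
  have ht : (0 : ℝ) < t := ht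
  rw [← ENNReal.ofReal_mul (by positivity)]
  ring_nf

lemma lintegral_rpow_norm_mul_sq_charFun_lt_top {d : ℕ} (hd : 2 ≤ d) {s : ℝ} (hs : 1 / 2 < s)
    (hs1 : s < 1) (μ : Measure (Ed d)) [IsFiniteMeasure μ] {C : ℝ} (hC : 0 ≤ C)
    (hμ : ∀ᵐ x ∂μ, ∀ r : ℝ, 0 < r → μ (Metric.ball x r) ≤ ENNReal.ofReal (C * r ^ (d - 1))) :
    ∫⁻ ξ : Ed d, ENNReal.ofReal (‖ξ‖ ^ (-(2 * s))) * ‖charFun μ ξ‖ₑ ^ 2 < ∞ := by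
  have hd' : (2 : ℝ) ≤ d := by exact_mod_cast hd
  have hG := Real.Gamma_pos_of_pos (by linarith : 0 < s)
  set F : ℝ → ℝ≥0∞ := fun t => ∫⁻ ξ : Ed d,
    ENNReal.ofReal (Real.exp (-t * ‖ξ‖ ^ 2)) * ‖charFun μ ξ‖ₑ ^ 2 with hF
  set D : ℝ := C * 2 ^ (d - 1) * Real.Gamma (((d - 1 : ℕ) : ℝ) / 2 + 1)
  have hD0 : 0 ≤ D := by
    have := Real.Gamma_pos_of_pos (by positivity : 0 < ((d - 1 : ℕ) : ℝ) / 2 + 1)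
    positivity
  have hsmall (t : ℝ) (ht : 0 < t) : ENNReal.ofReal (t ^ (s - 1)) * F t ≤
      μ Set.univ * ENNReal.ofReal (Real.pi ^ ((d : ℝ) / 2) * D) *
        ENNReal.ofReal (t ^ (s - 3 / 2)) := by
    have h1 : ∫⁻ x, ∫⁻ y, ENNReal.ofReal (Real.exp (-(‖x - y‖ ^ 2 / (4 * t)))) ∂μ ∂μ ≤
        ENNReal.ofReal (D * t ^ (((d - 1 : ℕ) : ℝ) / 2)) * μ Set.univ := by
      rw [← lintegral_const]
      exact lintegral_mono_ae (hμ.mono fun x hx => lintegral_gaussian_le_of_ball_le hC hx ht)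
    simp only [hF]
    rw [lintegral_gaussian_mul_sq_enorm_charFun μ ht]
    refine (mul_le_mul_right (mul_le_mul_right h1 _) _).trans_eq ?_
    rw [← mul_assoc, ← mul_assoc, mul_comm _ (μ Set.univ), mul_assoc (μ Set.univ),
      ← ENNReal.ofReal_mul (by positivity), ← ENNReal.ofReal_mul (by positivity),
      ← ENNReal.ofReal_mul (by positivity)]
    congr 2
    have h2 : t ^ (s - 3 / 2) =
        t ^ (s - 1) * (t ^ ((d : ℝ) / 2))⁻¹ * t ^ (((d - 1 : ℕ) : ℝ) / 2) := by
      rw [← Real.rpow_neg ht.le, ← Real.rpow_add ht, ← Real.rpow_add ht,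
        Nat.cast_sub (by omega)]
      congr 1
      push_cast
      ring
    rw [h2, Real.div_rpow Real.pi_pos.le ht.le]
    ring
  have hlarge (t : ℝ) (ht : 0 < t) : ENNReal.ofReal (t ^ (s - 1)) * F t ≤
      μ Set.univ * μ Set.univ * ENNReal.ofReal (Real.pi ^ ((d : ℝ) / 2)) *
        ENNReal.ofReal (t ^ (s - 1 - d / 2)) := by
    have h1 : ∫⁻ x, ∫⁻ y, ENNReal.ofReal (Real.exp (-(‖x - y‖ ^ 2 / (4 * t)))) ∂μ ∂μ ≤
        μ Set.univ * μ Set.univ := by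
      rw [← lintegral_const]
      refine lintegral_mono fun x => ?_
      rw [← one_mul (μ Set.univ), ← lintegral_const]
      refine lintegral_mono fun y => ?_
      rw [ENNReal.ofReal_le_one, Real.exp_le_one_iff]
      have : 0 ≤ ‖x - y‖ ^ 2 / (4 * t) := by positivity
      linarith
    simp only [hF]
    rw [lintegral_gaussian_mul_sq_enorm_charFun μ ht]
    refine (mul_le_mul_right (mul_le_mul_right h1 _) _).trans_eq ?_
    rw [← mul_assoc, mul_comm _ (μ Set.univ * μ Set.univ), mul_assoc (μ Set.univ * μ Set.univ),
      ← ENNReal.ofReal_mul (by positivity), ← ENNReal.ofReal_mul (by positivity)]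
    congr 2
    rw [Real.rpow_sub ht (s - 1), Real.div_rpow Real.pi_pos.le ht.le]
    ring
  have hfin : ∫⁻ t in Set.Ioi (0 : ℝ), ENNReal.ofReal (t ^ (s - 1)) * F t < ∞ := by
    rw [← Set.Ioc_union_Ioi_eq_Ioi zero_le_one, lintegral_union measurableSet_Ioi
      (Set.Ioc_disjoint_Ioi le_rfl), ENNReal.add_lt_top]
    constructor
    · refine (setLIntegral_mono' measurableSet_Ioc fun t ht => hsmall t ht.1).trans_lt ?_
      rw [lintegral_const_mul _ (by fun_prop)]
      refine ENNReal.mul_lt_top (ENNReal.mul_lt_top (measure_lt_top _ _) ENNReal.ofReal_lt_top) ?_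
      exact ((intervalIntegral.intervalIntegrable_rpow' (a := 0) (b := 1)
        (by linarith : -1 < s - 3 / 2)).1).lintegral_lt_top
    · refine (setLIntegral_mono' measurableSet_Ioi fun t ht =>
        hlarge t (zero_lt_one.trans ht)).trans_lt ?_
      rw [lintegral_const_mul _ (by fun_prop)]
      refine ENNReal.mul_lt_top (ENNReal.mul_lt_top (ENNReal.mul_lt_top (measure_lt_top _ _)
        (measure_lt_top _ _)) ENNReal.ofReal_lt_top) ?_
      exact (integrableOn_Ioi_rpow_of_lt (by linarith : s - 1 - d / 2 < -1)
        zero_lt_one).lintegral_lt_top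
  have hle : ENNReal.ofReal (Real.Gamma s) *
      ∫⁻ ξ : Ed d, ENNReal.ofReal (‖ξ‖ ^ (-(2 * s))) * ‖charFun μ ξ‖ₑ ^ 2 ≤
      ∫⁻ t in Set.Ioi (0 : ℝ), ENNReal.ofReal (t ^ (s - 1)) * F t := by
    calc ENNReal.ofReal (Real.Gamma s) *
          ∫⁻ ξ : Ed d, ENNReal.ofReal (‖ξ‖ ^ (-(2 * s))) * ‖charFun μ ξ‖ₑ ^ 2
        = ∫⁻ ξ : Ed d, ENNReal.ofReal (Real.Gamma s) * ENNReal.ofReal (‖ξ‖ ^ (-(2 * s))) *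
            ‖charFun μ ξ‖ₑ ^ 2 := by
          rw [← lintegral_const_mul' _ _ ENNReal.ofReal_ne_top]
          simp_rw [mul_assoc]
      _ ≤ ∫⁻ ξ : Ed d, ∫⁻ t in Set.Ioi (0 : ℝ), ENNReal.ofReal (t ^ (s - 1)) *
            ENNReal.ofReal (Real.exp (-t * ‖ξ‖ ^ 2)) * ‖charFun μ ξ‖ₑ ^ 2 := by
          refine lintegral_mono fun ξ => ?_
          rw [lintegral_mul_const _ (by fun_prop)]
          gcongr
          exact ofReal_rpow_norm_le_lintegral (by linarith) ξ
      _ = ∫⁻ t in Set.Ioi (0 : ℝ), ∫⁻ ξ : Ed d, ENNReal.ofReal (t ^ (s - 1)) *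
            ENNReal.ofReal (Real.exp (-t * ‖ξ‖ ^ 2)) * ‖charFun μ ξ‖ₑ ^ 2 :=
          lintegral_lintegral_swap (Measurable.aemeasurable (by fun_prop))
      _ = _ := by
          congr 1 with t
          simp only [hF]
          rw [← lintegral_const_mul' _ _ ENNReal.ofReal_ne_top]
          simp_rw [mul_assoc]
  by_contra hcon
  rw [not_lt_top_iff] at hcon
  rw [hcon, ENNReal.mul_top (by simpa using hG)] at hle
  exact (hle.trans_lt hfin).ne rfl

lemma lintegral_comp_smul_of_pos {d : ℕ} (f : Ed d → ℝ≥0∞) {R : ℝ} (hR : 0 < R) :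
    ∫⁻ x : Ed d, f (R • x) = ENNReal.ofReal (R ^ (-(d : ℝ))) * ∫⁻ x, f x := by
  have hemb : MeasurableEmbedding (fun x : Ed d => R • x) :=
    (Homeomorph.smulOfNeZero R hR.ne').measurableEmbedding
  rw [← hemb.lintegral_map, Measure.map_addHaar_smul _ hR.ne', lintegral_smul_measure,
    finrank_euclideanSpace_fin, abs_of_pos (by positivity), Real.rpow_neg hR.le,
    Real.rpow_natCast, smul_eq_mul]

/-- The surface measure of the unit sphere, as a measure on the ambient space. -/
def unitSphereMeasure (d : ℕ) : Measure (Ed d) :=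
  (volume : Measure (Ed d)).toSphere.map (↑)

instance (d : ℕ) : IsFiniteMeasure (unitSphereMeasure d) := by
  unfold unitSphereMeasure; infer_instance

lemma unitSphereMeasure_univ_ne_zero {d : ℕ} (hd : 2 ≤ d) :
    unitSphereMeasure d Set.univ ≠ 0 := by
  have : Nonempty (Fin d) := ⟨⟨0, by omega⟩⟩
  rw [unitSphereMeasure, Measure.map_apply measurable_subtype_coe .univ, Set.preimage_univ]
  exact Measure.measure_univ_ne_zero.2 (Measure.toSphere_ne_zero _)

lemma ae_unitSphereMeasure_norm (d : ℕ) : ∀ᵐ x ∂unitSphereMeasure d, ‖x‖ = 1 := by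
  rw [unitSphereMeasure, ae_map_iff measurable_subtype_coe.aemeasurable
    (measurableSet_eq_fun (by fun_prop) (by fun_prop))]
  exact Filter.Eventually.of_forall fun x => by simp

lemma unitSphereMeasure_ball_le {d : ℕ} (hd : 2 ≤ d) : ∃ C : ℝ, 0 ≤ C ∧
    ∀ᵐ x ∂unitSphereMeasure d, ∀ r : ℝ, 0 < r →
      unitSphereMeasure d (Metric.ball x r) ≤ ENNReal.ofReal (C * r ^ (d - 1)) := by
  obtain ⟨C, hC, h⟩ := toSphere_ball_le hd
  refine ⟨C, hC, (ae_unitSphereMeasure_norm d).mono fun x hx r hr => ?_⟩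
  rw [unitSphereMeasure,
    Measure.map_apply measurable_subtype_coe Metric.isOpen_ball.measurableSet]
  exact h ⟨x, by simpa using hx⟩ r hr

open scoped FourierTransform SchwartzMap

lemma FT_smul_two_pi {d : ℕ} (u : 𝓢(Ed d, ℂ)) (w : Ed d) :
    FT u ((2 * Real.pi) • w) = 𝓕 u w := by
  rw [SchwartzMap.fourier_coe, Real.fourier_eq', FT]
  congr 1 with v
  rw [inner_smul_right, smul_eq_mul]
  push_cast
  ring_nf

lemma FT_eq_fourier {d : ℕ} (u : 𝓢(Ed d, ℂ)) (ξ : Ed d) :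
    FT u ξ = 𝓕 u ((2 * Real.pi)⁻¹ • ξ) := by
  rw [← FT_smul_two_pi, smul_inv_smul₀ (by positivity)]

lemma continuous_FT {d : ℕ} (u : 𝓢(Ed d, ℂ)) : Continuous (FT u) := by
  rw [show FT u = fun ξ => 𝓕 u ((2 * Real.pi)⁻¹ • ξ) from funext (FT_eq_fourier u)]
  fun_prop

lemma memLp_rpow_norm_mul_FT {d : ℕ} {s : ℝ} (hs : 0 < s) (hs1 : s < 1) (u : 𝓢(Ed d, ℂ)) :
    MemLp (fun ξ : Ed d => ((‖ξ‖ ^ s : ℝ) : ℂ) * FT u ξ) 2 := by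
  have hcont := continuous_FT u
  have hmeas : AEStronglyMeasurable (fun ξ : Ed d => ((‖ξ‖ ^ s : ℝ) : ℂ) * FT u ξ) :=
    Measurable.aestronglyMeasurable (by fun_prop)
  rw [memLp_two_iff_integrable_sq_norm hmeas]
  obtain ⟨A, hA⟩ := (𝓕 u).toBoundedContinuousFunction.isBounded_range.exists_norm_le
  have hA' (w : Ed d) : ‖𝓕 u w‖ ≤ A := hA _ ⟨w, rfl⟩
  have hint : Integrable (fun w : Ed d => A * (‖𝓕 u w‖ + (2 * Real.pi) ^ 2 *
      (‖w‖ ^ 2 * ‖𝓕 u w‖))) :=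
    (((𝓕 u).integrable.norm).add (((𝓕 u).integrable_pow_mul volume 2).const_mul _)).const_mul _
  have hint' := hint.comp_smul (R := (2 * Real.pi)⁻¹) (by positivity)
  refine hint'.mono' (hmeas.norm.pow 2) (Filter.Eventually.of_forall fun ξ => ?_)
  have hrpow : (‖ξ‖ ^ s) ^ 2 ≤ 1 + ‖ξ‖ ^ 2 := by
    rcases le_or_gt ‖ξ‖ 1 with h | h
    · have : ‖ξ‖ ^ s ≤ 1 := Real.rpow_le_one (norm_nonneg _) h hs.le
      have h0 : 0 ≤ ‖ξ‖ ^ s := by positivity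
      nlinarith [sq_nonneg ‖ξ‖]
    · have : ‖ξ‖ ^ s ≤ ‖ξ‖ := by
        simpa using Real.rpow_le_rpow_of_exponent_le h.le hs1.le
      have h0 : 0 ≤ ‖ξ‖ ^ s := by positivity
      nlinarith
  have hnorm : ‖(2 * Real.pi)⁻¹ • ξ‖ = (2 * Real.pi)⁻¹ * ‖ξ‖ := by
    rw [norm_smul, Real.norm_of_nonneg (by positivity)]
  rw [norm_pow, norm_norm, norm_mul, Complex.norm_real, Real.norm_of_nonneg (by positivity),
    FT_eq_fourier, hnorm]
  set z := ‖𝓕 u ((2 * Real.pi)⁻¹ • ξ)‖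
  have hz : z ≤ A := hA' _
  have hz0 : 0 ≤ z := norm_nonneg _
  calc (‖ξ‖ ^ s * z) ^ 2 = (‖ξ‖ ^ s) ^ 2 * (z * z) := by ring
    _ ≤ (1 + ‖ξ‖ ^ 2) * (A * z) := by gcongr
    _ = _ := by
      have := Real.pi_pos
      field_simp

lemma integral_comp_smul_eq_integral_fourier_mul_charFun {d : ℕ} (μ : Measure (Ed d))
    [IsFiniteMeasure μ] (u : 𝓢(Ed d, ℂ)) (R : ℝ) :
    ∫ ω, u (R • ω) ∂μ = ∫ w : Ed d, 𝓕 u w * charFun μ (R • (2 * Real.pi) • w) := by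
  have hinv (ω : Ed d) : u (R • ω) =
      ∫ w : Ed d, cexp ((⟪ω, R • (2 * Real.pi) • w⟫ : ℝ) * I) * 𝓕 u w := by
    have h : 𝓕⁻ (𝓕 u) = u := FourierTransform.fourierInv_fourier_eq u
    conv_lhs => rw [← h]
    rw [SchwartzMap.fourierInv_coe, Real.fourierInv_eq']
    congr 1 with w
    rw [inner_smul_right, inner_smul_right, inner_smul_right, real_inner_comm, smul_eq_mul]
    push_cast
    ring_nf
  have hint : Integrable (Function.uncurry fun (ω w : Ed d) =>
      cexp ((⟪ω, R • (2 * Real.pi) • w⟫ : ℝ) * I) * 𝓕 u w) (μ.prod volume) := by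
    refine Integrable.bdd_mul (c := 1) ((𝓕 u).integrable.comp_snd μ) ?_ ?_
    · exact Continuous.aestronglyMeasurable (by fun_prop)
    · exact Filter.Eventually.of_forall fun q => by rw [Complex.norm_exp_ofReal_mul_I]
  simp_rw [hinv]
  rw [integral_integral_swap hint]
  congr 1 with w
  rw [integral_mul_const, charFun_apply, mul_comm]

lemma enorm_integral_comp_smul_le {d : ℕ} (hd : 2 ≤ d) (μ : Measure (Ed d)) [IsFiniteMeasure μ]
    (u : 𝓢(Ed d, ℂ)) (s : ℝ) {R : ℝ} (hR : 0 < R) :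
    ‖∫ ω, u (R • ω) ∂μ‖ₑ ≤ ENNReal.ofReal ((2 * Real.pi) ^ (-(d : ℝ))) *
      (eLpNorm (fun ξ : Ed d => ((‖ξ‖ ^ s : ℝ) : ℂ) * FT u ξ) 2 volume *
        (ENNReal.ofReal (R ^ (2 * s - d)) *
          ∫⁻ ξ : Ed d, ENNReal.ofReal (‖ξ‖ ^ (-(2 * s))) * ‖charFun μ ξ‖ₑ ^ 2) ^ (1 / 2 : ℝ)) := by
  have : Nonempty (Fin d) := ⟨⟨0, by omega⟩⟩
  have hcont := continuous_FT u
  have hscale : ∫⁻ ξ : Ed d, (ENNReal.ofReal (‖ξ‖ ^ (-s)) * ‖charFun μ (R • ξ)‖ₑ) ^ (2 : ℝ) =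
      ENNReal.ofReal (R ^ (2 * s - d)) *
        ∫⁻ ξ : Ed d, ENNReal.ofReal (‖ξ‖ ^ (-(2 * s))) * ‖charFun μ ξ‖ₑ ^ 2 := by
    calc ∫⁻ ξ : Ed d, (ENNReal.ofReal (‖ξ‖ ^ (-s)) * ‖charFun μ (R • ξ)‖ₑ) ^ (2 : ℝ)
        = ∫⁻ ξ : Ed d, ENNReal.ofReal (R ^ (2 * s)) * (ENNReal.ofReal (‖R • ξ‖ ^ (-(2 * s))) *
            ‖charFun μ (R • ξ)‖ₑ ^ 2) := by
          congr 1 with ξ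
          rw [ENNReal.rpow_two, mul_pow, ← mul_assoc, ← ENNReal.ofReal_mul (by positivity),
            ← ENNReal.ofReal_pow (by positivity), norm_smul, Real.norm_of_nonneg hR.le,
            Real.mul_rpow hR.le (norm_nonneg _), ← mul_assoc, ← Real.rpow_add hR, ← Real.rpow_two,
            ← Real.rpow_mul (norm_nonneg _)]
          ring_nf
          simp [mul_comm]
      _ = _ := by
          rw [lintegral_const_mul' _ _ ENNReal.ofReal_ne_top, lintegral_comp_smul_of_pos
            (fun ξ => ENNReal.ofReal (‖ξ‖ ^ (-(2 * s))) * ‖charFun μ ξ‖ₑ ^ 2) hR, ← mul_assoc,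
            ← ENNReal.ofReal_mul (by positivity), ← Real.rpow_add hR, sub_eq_add_neg]
  have hL2 : (∫⁻ ξ : Ed d, (ENNReal.ofReal (‖ξ‖ ^ s) * ‖FT u ξ‖ₑ) ^ (2 : ℝ)) ^ (1 / 2 : ℝ) =
      eLpNorm (fun ξ : Ed d => ((‖ξ‖ ^ s : ℝ) : ℂ) * FT u ξ) 2 volume := by
    rw [eLpNorm_eq_lintegral_rpow_enorm_toReal (by norm_num) (by norm_num)]
    simp only [ENNReal.toReal_ofNat]
    congr 2 with ξ
    rw [enorm_mul, ← ofReal_norm (((‖ξ‖ ^ s : ℝ) : ℂ)), Complex.norm_real,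
      Real.norm_of_nonneg (by positivity)]
  rw [integral_comp_smul_eq_integral_fourier_mul_charFun]
  calc ‖∫ w : Ed d, 𝓕 u w * charFun μ (R • (2 * Real.pi) • w)‖ₑ
      ≤ ∫⁻ w : Ed d, ‖FT u ((2 * Real.pi) • w)‖ₑ * ‖charFun μ (R • (2 * Real.pi) • w)‖ₑ := by
        refine (enorm_integral_le_lintegral_enorm _).trans_eq ?_
        simp_rw [enorm_mul, FT_smul_two_pi]
    _ = ENNReal.ofReal ((2 * Real.pi) ^ (-(d : ℝ))) *
          ∫⁻ ξ : Ed d, ‖FT u ξ‖ₑ * ‖charFun μ (R • ξ)‖ₑ :=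
        lintegral_comp_smul_of_pos (fun ξ => ‖FT u ξ‖ₑ * ‖charFun μ (R • ξ)‖ₑ) (by positivity)
    _ = ENNReal.ofReal ((2 * Real.pi) ^ (-(d : ℝ))) *
          ∫⁻ ξ : Ed d, ((fun ξ => ENNReal.ofReal (‖ξ‖ ^ s) * ‖FT u ξ‖ₑ) *
            fun ξ => ENNReal.ofReal (‖ξ‖ ^ (-s)) * ‖charFun μ (R • ξ)‖ₑ) ξ := by
        congr 1
        refine lintegral_congr_ae ?_
        filter_upwards [Measure.ae_ne volume (0 : Ed d)] with ξ hξ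
        have hξ' : 0 < ‖ξ‖ := norm_pos_iff.2 hξ
        rw [Pi.mul_apply, mul_mul_mul_comm, ← ENNReal.ofReal_mul (by positivity),
          ← Real.rpow_add hξ', add_neg_cancel, Real.rpow_zero, ENNReal.ofReal_one, one_mul]
    _ ≤ _ := by
        rw [← hscale, ← hL2]
        gcongr
        exact ENNReal.lintegral_mul_le_Lp_mul_Lq volume Real.HolderConjugate.two_two
          (Measurable.aemeasurable (by fun_prop)) (Measurable.aemeasurable (by fun_prop))

theorem stmt0 (d : ℕ) (hd : 2 ≤ d) (s : ℝ) (hs : 1/2 < s) (hs1 : s < 1) :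
    ∃ C : ℝ, 0 < C ∧ ∀ u : SchwartzMap (Ed d) ℂ, IsRadial (⇑u) →
      ∀ x : Ed d, ‖x‖ ^ (((d : ℝ) - 2 * s) / 2) * ‖u x‖ ≤ C * HdotNorm s (⇑u) := by
  have hd' : (2 : ℝ) ≤ d := by exact_mod_cast hd
  obtain ⟨A, hA, hball⟩ := unitSphereMeasure_ball_le hd
  have hK := lintegral_rpow_norm_mul_sq_charFun_lt_top hd hs hs1 (unitSphereMeasure d) hA hball
  set K := ∫⁻ ξ : Ed d, ENNReal.ofReal (‖ξ‖ ^ (-(2 * s))) * ‖charFun (unitSphereMeasure d) ξ‖ₑ ^ 2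
  set M := (unitSphereMeasure d).real Set.univ
  have hM0 : 0 < M :=
    ENNReal.toReal_pos (unitSphereMeasure_univ_ne_zero hd) (measure_ne_top _ _)
  refine ⟨(2 * Real.pi) ^ (-(d : ℝ) / 2) * K.toReal ^ (1 / 2 : ℝ) / M + 1, by positivity,
    fun u hu x => ?_⟩
  have hH : 0 ≤ HdotNorm s u := by unfold HdotNorm; positivity
  rcases eq_or_ne x 0 with rfl | hx
  · rw [norm_zero, Real.zero_rpow (by linarith), zero_mul]
    positivity
  have hR : 0 < ‖x‖ := norm_pos_iff.2 hx
  have havg : ∫ ω, u (‖x‖ • ω) ∂unitSphereMeasure d = M * u x := by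
    rw [integral_congr_ae (g := fun _ => u x)
      ((ae_unitSphereMeasure_norm d).mono fun ω hω => hu _ _ (by simp [norm_smul, hω])),
      integral_const, Complex.real_smul]
  have hN := (memLp_rpow_norm_mul_FT (by linarith) hs1 u).eLpNorm_ne_top
  have hmain := enorm_integral_comp_smul_le hd (unitSphereMeasure d) u s hR
  rw [havg] at hmain
  change _ ≤ _ * (_ * (_ * K) ^ _) at hmain
  have hmain' := ENNReal.toReal_mono (by finiteness) hmain
  simp only [toReal_enorm, ENNReal.toReal_mul, ← ENNReal.toReal_rpow] at hmain'
  rw [norm_mul, Complex.norm_real, Real.norm_of_nonneg hM0.le,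
    ENNReal.toReal_ofReal (by positivity), ENNReal.toReal_ofReal (by positivity),
    Real.mul_rpow (x := ‖x‖ ^ _) (by positivity) (by positivity), ← Real.rpow_mul hR.le] at hmain'
  have hcancel : ‖x‖ ^ (((d : ℝ) - 2 * s) / 2) * ‖x‖ ^ ((2 * s - d) * (1 / 2)) = 1 := by
    rw [← Real.rpow_add hR]
    convert Real.rpow_zero ‖x‖ using 2
    ring
  have hpi : (2 * Real.pi) ^ (-(d : ℝ)) =
      (2 * Real.pi) ^ (-(d : ℝ) / 2) * (2 * Real.pi) ^ (-(d : ℝ) / 2) := by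
    rw [← Real.rpow_add (by positivity)]
    ring_nf
  have hbound : ‖x‖ ^ (((d : ℝ) - 2 * s) / 2) * ‖u x‖ ≤
      (2 * Real.pi) ^ (-(d : ℝ) / 2) * K.toReal ^ (1 / 2 : ℝ) / M * HdotNorm s u := by
    rw [div_mul_eq_mul_div, le_div_iff₀ hM0, HdotNorm]
    calc ‖x‖ ^ (((d : ℝ) - 2 * s) / 2) * ‖u x‖ * M
        = ‖x‖ ^ (((d : ℝ) - 2 * s) / 2) * (M * ‖u x‖) := by ring
      _ ≤ _ := mul_le_mul_of_nonneg_left hmain' (by positivity)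
      _ = _ := by
        rw [hpi]
        linear_combination ((2 * Real.pi) ^ (-(d : ℝ) / 2) * (2 * Real.pi) ^ (-(d : ℝ) / 2) *
          (eLpNorm (fun ξ : Ed d => ((‖ξ‖ ^ s : ℝ) : ℂ) * FT u ξ) 2 volume).toReal *
          K.toReal ^ (1 / 2 : ℝ)) * hcancel
  linarith

end
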